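/- Let O ⊆ ℝᵐ be a nonempty convex set and u : Ω → ℝᵐ a harmonic map on an open set Ω ⊆ ℝⁿ (each component harmonic). Then the composition x ↦ dist(u(x), O) is subharmonic on Ω, i.e., satisfies the sub-mean-value inequality on every ball contained in Ω. -/

import Mathlib

open MeasureTheory Metric Real

/-- The Laplacian (componentwise, for vector-valued maps) on Euclidean space. -/
noncomputable def lap {n : ℕ} {F : Type*} [NormedAddCommGroup F] [NormedSpace ℝ F]
    (u : EuclideanSpace ℝ (Fin n) → F) (x : EuclideanSpace ℝ (Fin n)) : F :=
  ∑ i : Fin n,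
    fderiv ℝ (fun y => fderiv ℝ u y (EuclideanSpace.single i 1)) x (EuclideanSpace.single i 1)

section Laplacian

variable {n : ℕ} {F G : Type*} [NormedAddCommGroup F] [NormedSpace ℝ F]
  [NormedAddCommGroup G] [NormedSpace ℝ G]

theorem Filter.EventuallyEq.lap_eq {f g : EuclideanSpace ℝ (Fin n) → F}
    {x : EuclideanSpace ℝ (Fin n)} (h : f =ᶠ[nhds x] g) : lap f x = lap g x := by
  unfold lap
  refine Finset.sum_congr rfl fun i _ => ?_
  have : (fun y => fderiv ℝ f y (EuclideanSpace.single i 1)) =ᶠ[nhds x]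
      fun y => fderiv ℝ g y (EuclideanSpace.single i 1) :=
    (h.fderiv (𝕜 := ℝ)).mono fun y hy => by simp only [hy]
  rw [this.fderiv_eq]

theorem lap_comp_add_left (f : EuclideanSpace ℝ (Fin n) → F) (a x : EuclideanSpace ℝ (Fin n)) :
    lap (fun y => f (a + y)) x = lap f (a + x) := by
  unfold lap
  refine Finset.sum_congr rfl fun i _ => ?_
  simp_rw [fderiv_comp_add_left]
  rw [fderiv_comp_add_left (f := fun y => fderiv ℝ f y (EuclideanSpace.single i 1))]

theorem ContinuousLinearMap.lap_comp (L : F →L[ℝ] G) {f : EuclideanSpace ℝ (Fin n) → F}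
    {x : EuclideanSpace ℝ (Fin n)} (hf : ContDiffAt ℝ 2 f x) :
    lap (fun y => L (f y)) x = L (lap f x) := by
  unfold lap
  rw [map_sum]
  refine Finset.sum_congr rfl fun i _ => ?_
  have h1 : (fun y => fderiv ℝ (fun y => L (f y)) y (EuclideanSpace.single i 1)) =ᶠ[nhds x]
      fun y => L (fderiv ℝ f y (EuclideanSpace.single i 1)) := by
    filter_upwards [hf.eventually (by simp)] with y hy
    have := (L.hasFDerivAt.comp y (hy.differentiableAt (by simp)).hasFDerivAt).fderiv
    simp only [Function.comp_def] at this
    simp [this]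
  have h2 : DifferentiableAt ℝ (fun y => fderiv ℝ f y (EuclideanSpace.single i 1)) x :=
    ((hf.fderiv_right (m := 1) (by norm_num)).differentiableAt (by simp)).clm_apply
      (differentiableAt_const _)
  rw [h1.fderiv_eq]
  have := (L.hasFDerivAt.comp x h2.hasFDerivAt).fderiv
  simp only [Function.comp_def] at this
  simp [this]

end Laplacian

theorem lipschitzWith_max_sq_sub_norm_sq {E : Type*} [NormedAddCommGroup E] {s : ℝ} (hs : 0 ≤ s) :
    LipschitzWith (2 * s).toNNReal fun x : E => max (s ^ 2 - ‖x‖ ^ 2) 0 := by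
  refine LipschitzWith.of_dist_le_mul fun x y => ?_
  rw [Real.coe_toNNReal _ (by positivity), Real.dist_eq, dist_eq_norm]
  have h := abs_le.1 (abs_norm_sub_norm_le x y)
  have hx := norm_nonneg x
  have hy := norm_nonneg y
  have hd := norm_nonneg (x - y)
  rw [abs_le]
  rcases max_cases (s ^ 2 - ‖x‖ ^ 2) 0 with ⟨h1, h2⟩ | ⟨h1, h2⟩ <;>
  rcases max_cases (s ^ 2 - ‖y‖ ^ 2) 0 with ⟨h3, h4⟩ | ⟨h3, h4⟩ <;> rw [h1, h3]
  · have hxs : ‖x‖ ≤ s := by nlinarith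
    have hys : ‖y‖ ≤ s := by nlinarith
    constructor <;> nlinarith
  · have hxs : ‖x‖ ≤ s := by nlinarith
    have hys : s ≤ ‖y‖ := by nlinarith
    constructor <;> nlinarith
  · have hxs : s ≤ ‖x‖ := by nlinarith
    have hys : ‖y‖ ≤ s := by nlinarith
    constructor <;> nlinarith
  · constructor <;> nlinarith

section Paraboloid

variable {E : Type*} [NormedAddCommGroup E] [InnerProductSpace ℝ E]

theorem hasCompactSupport_max_sq_sub_norm_sq [FiniteDimensional ℝ E] {s : ℝ} (hs : 0 ≤ s) :
    HasCompactSupport fun x : E => max (s ^ 2 - ‖x‖ ^ 2) 0 := by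
  refine HasCompactSupport.intro (isCompact_closedBall 0 s) fun x hx => max_eq_right ?_
  have : s < ‖x‖ := by simpa using hx
  nlinarith

theorem lineDeriv_max_sq_sub_norm_sq_of_mem_ball {s : ℝ} {x : E} (hx : x ∈ ball 0 s) (v : E) :
    lineDeriv ℝ (fun x : E => max (s ^ 2 - ‖x‖ ^ 2) 0) x v = -(2 * inner ℝ x v) := by
  have h : (fun x : E => max (s ^ 2 - ‖x‖ ^ 2) 0) =ᶠ[nhds x] fun x => s ^ 2 - ‖x‖ ^ 2 := by
    filter_upwards [isOpen_ball.mem_nhds hx] with y hy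
    have : ‖y‖ < s := by simpa using hy
    exact max_eq_left (by nlinarith [norm_nonneg y])
  rw [h.lineDeriv_eq]
  have h2 : HasFDerivAt (fun x : E => s ^ 2 - ‖x‖ ^ 2) (-(2 • innerSL ℝ x)) x :=
    (hasStrictFDerivAt_norm_sq x).hasFDerivAt.const_sub _
  rw [(h2.hasLineDerivAt v).lineDeriv]
  simp

theorem lineDeriv_max_sq_sub_norm_sq_of_notMem_closedBall {s : ℝ} (hs : 0 ≤ s) {x : E}
    (hx : x ∉ closedBall 0 s) (v : E) :
    lineDeriv ℝ (fun x : E => max (s ^ 2 - ‖x‖ ^ 2) 0) x v = 0 := by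
  have h : (fun x : E => max (s ^ 2 - ‖x‖ ^ 2) 0) =ᶠ[nhds x] fun _ => 0 := by
    filter_upwards [isClosed_closedBall.isOpen_compl.mem_nhds hx] with y hy
    have : s < ‖y‖ := by simpa using hy
    exact max_eq_right (by nlinarith)
  rw [h.lineDeriv_eq]
  simp [lineDeriv]

end Paraboloid

section MeanValue

variable {n : ℕ}

theorem setIntegral_ball_fderiv_self_eq_zero {u : EuclideanSpace ℝ (Fin n) → ℝ}
    (hu : ContDiff ℝ 2 u) (hc : HasCompactSupport u) {s : ℝ} (hs : 0 < s)
    (hlap : ∀ x ∈ ball 0 s, lap u x = 0) :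
    ∫ x in ball 0 s, fderiv ℝ u x x = 0 := by
  let g : EuclideanSpace ℝ (Fin n) → ℝ := fun x => max (s ^ 2 - ‖x‖ ^ 2) 0
  have hgl := lipschitzWith_max_sq_sub_norm_sq (E := EuclideanSpace ℝ (Fin n)) hs.le
  have hgc := hasCompactSupport_max_sq_sub_norm_sq (E := EuclideanSpace ℝ (Fin n)) hs.le
  let f : Fin n → EuclideanSpace ℝ (Fin n) → ℝ :=
    fun i x => fderiv ℝ u x (EuclideanSpace.single i 1)
  have hf1 (i) : ContDiff ℝ 1 (f i) := (hu.fderiv_right (by norm_num)).clm_apply contDiff_const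
  have hfc (i) : HasCompactSupport (f i) := hc.fderiv_apply ℝ _
  have hfd (i) (x) : lineDeriv ℝ (f i) x (EuclideanSpace.single i 1)
      = fderiv ℝ (f i) x (EuclideanSpace.single i 1) :=
    ((hf1 i).differentiable (by simp) x).lineDeriv_eq_fderiv
  have key (i) : ∫ x, fderiv ℝ (f i) x (EuclideanSpace.single i 1) * g x
      = ∫ x in ball 0 s, 2 * (x i * f i x) := by
    obtain ⟨C, hC⟩ := (hf1 i).lipschitzWith_of_hasCompactSupport (hfc i) (by simp)
    have := LipschitzWith.integral_lineDeriv_mul_eq (μ := volume) hC hgl hgc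
      (EuclideanSpace.single i 1)
    simp_rw [hfd] at this
    rw [this, ← integral_indicator measurableSet_ball]
    refine integral_congr_ae ?_
    have hsph : ∀ᵐ x : EuclideanSpace ℝ (Fin n), x ∉ sphere (0 : EuclideanSpace ℝ (Fin n)) s :=
      measure_eq_zero_iff_ae_notMem.1 (Measure.addHaar_sphere_of_ne_zero volume 0 hs.ne')
    filter_upwards [hsph] with x hx
    by_cases hxb : x ∈ ball 0 s
    · rw [Set.indicator_of_mem hxb, lineDeriv_max_sq_sub_norm_sq_of_mem_ball hxb]
      simp [EuclideanSpace.inner_single_right]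
      ring
    · rw [Set.indicator_of_notMem hxb, lineDeriv_max_sq_sub_norm_sq_of_notMem_closedBall hs.le,
        zero_mul]
      intro h
      rw [← ball_union_sphere] at h
      exact h.elim hxb hx
  have hsum (x) : fderiv ℝ u x x = ∑ i, x i * f i x := by
    conv_lhs => arg 2; rw [← (EuclideanSpace.basisFun (Fin n) ℝ).sum_repr x]
    simp [f]
  have hint (i) : IntegrableOn (fun x => 2 * (x i * f i x)) (ball 0 s) := by
    have hcont : Continuous fun x : EuclideanSpace ℝ (Fin n) => 2 * (x i * f i x) := by
      have := (hf1 i).continuous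
      fun_prop
    exact (hcont.continuousOn.integrableOn_compact (isCompact_closedBall 0 s)).mono_set
      ball_subset_closedBall
  have hint' (i) : Integrable fun x => fderiv ℝ (f i) x (EuclideanSpace.single i 1) * g x :=
    Continuous.integrable_of_hasCompactSupport
      ((((hf1 i).continuous_fderiv (by simp)).clm_apply continuous_const).mul hgl.continuous)
      hgc.mul_left
  have h2 : 2 * ∫ x in ball 0 s, fderiv ℝ u x x = 0 := by
    calc 2 * ∫ x in ball 0 s, fderiv ℝ u x x
        = ∫ x in ball 0 s, ∑ i, 2 * (x i * f i x) := by
          rw [← integral_const_mul]; simp_rw [hsum, Finset.mul_sum]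
      _ = ∑ i, ∫ x, fderiv ℝ (f i) x (EuclideanSpace.single i 1) * g x := by
          rw [integral_finsetSum _ fun i _ => hint i]; simp_rw [key]
      _ = ∫ x, lap u x * g x := by
          rw [← integral_finsetSum _ fun i _ => hint' i]
          simp_rw [← Finset.sum_mul]
          rfl
      _ = 0 := by
          refine integral_eq_zero_of_ae (Filter.Eventually.of_forall fun x => ?_)
          by_cases hx : x ∈ ball 0 s
          · simp [hlap x hx]
          · have : s ≤ ‖x‖ := by simpa using hx
            have : g x = 0 := max_eq_right (by nlinarith)
            simp [this]
  simpa using h2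

theorem setIntegral_ball_comp_smul_eq {u : EuclideanSpace ℝ (Fin n) → ℝ}
    (hu : ContDiff ℝ 2 u) (hc : HasCompactSupport u) {r : ℝ} (hr : 0 < r)
    (hlap : ∀ x ∈ ball 0 r, lap u x = 0) :
    ∫ x in ball 0 1, u (r • x) = ∫ _ in ball (0 : EuclideanSpace ℝ (Fin n)) 1, u 0 := by
  have hu1 : Continuous (fderiv ℝ u) := hu.continuous_fderiv (by simp)
  obtain ⟨C, hC⟩ := (hc.fderiv ℝ).exists_bound_of_continuous hu1
  have hfin : IsFiniteMeasure (volume.restrict (ball (0 : EuclideanSpace ℝ (Fin n)) 1)) :=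
    ⟨by simpa using measure_ball_lt_top⟩
  have hderiv (t : ℝ) : HasDerivAt (fun t : ℝ => ∫ x in ball 0 1, u (t • x))
      (∫ x in ball 0 1, fderiv ℝ u (t • x) x) t := by
    refine (hasDerivAt_integral_of_dominated_loc_of_deriv_le (s := Set.univ) (bound := fun _ => C)
      (F := fun (t : ℝ) x => u (t • x)) (F' := fun t x => fderiv ℝ u (t • x) x)
      Filter.univ_mem (Filter.Eventually.of_forall fun t => ?_) ?_ ?_ ?_ ?_ ?_).2
    · exact (hu.continuous.comp (continuous_const_smul t)).aestronglyMeasurable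
    · have : Continuous fun x => u (t • x) := hu.continuous.comp (continuous_const_smul t)
      exact (this.continuousOn.integrableOn_compact (isCompact_closedBall 0 1)).mono_set
        ball_subset_closedBall
    · exact ((hu1.comp (continuous_const_smul t)).clm_apply continuous_id).aestronglyMeasurable
    · filter_upwards [ae_restrict_mem measurableSet_ball] with x hx t _
      have hx1 : ‖x‖ < 1 := by simpa using hx
      have := (fderiv ℝ u (t • x)).le_opNorm x
      have := hC (t • x)
      nlinarith [norm_nonneg (fderiv ℝ u (t • x)), norm_nonneg x]
    · exact integrable_const C
    · refine Filter.Eventually.of_forall fun x t _ => ?_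
      have h1 := (hu.differentiable (by simp) (t • x)).hasFDerivAt
      have h2 : HasDerivAt (fun t : ℝ => t • x) x t := by
        simpa using (hasDerivAt_id t).smul_const x
      exact h1.comp_hasDerivAt t h2
  have hzero (t : ℝ) (ht : t ∈ Set.Ioo 0 r) : ∫ x in ball 0 1, fderiv ℝ u (t • x) x = 0 := by
    have h1 := setIntegral_ball_fderiv_self_eq_zero hu hc ht.1
      fun x hx => hlap x (ball_subset_ball ht.2.le hx)
    have h2 := Measure.setIntegral_comp_smul_of_pos volume (fun x => fderiv ℝ u x x)
      (ball (0 : EuclideanSpace ℝ (Fin n)) 1) ht.1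
    rw [smul_unitBall_of_pos ht.1, h1, smul_zero] at h2
    simp_rw [map_smul, smul_eq_mul] at h2
    rw [integral_const_mul] at h2
    exact (mul_eq_zero.1 h2).resolve_left ht.1.ne'
  obtain ⟨t, ht, hslope⟩ := exists_hasDerivAt_eq_slope
    (fun t : ℝ => ∫ x in ball (0 : EuclideanSpace ℝ (Fin n)) 1, u (t • x)) _ hr
    (fun t _ => (hderiv t).continuousAt.continuousWithinAt) (fun t _ => hderiv t)
  rw [hzero t ht, eq_comm, div_eq_zero_iff, sub_eq_zero] at hslope
  simpa using hslope.resolve_right (by linarith)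

theorem setAverage_ball_eq_of_lap_eq_zero {F : Type*} [NormedAddCommGroup F] [NormedSpace ℝ F]
    [CompleteSpace F] {Ω : Set (EuclideanSpace ℝ (Fin n))} (hΩ : IsOpen Ω)
    {u : EuclideanSpace ℝ (Fin n) → F} (hu : ContDiffOn ℝ 2 u Ω)
    (hlap : ∀ x ∈ Ω, lap u x = 0) {x₀ : EuclideanSpace ℝ (Fin n)} {r : ℝ} (hr : 0 < r)
    (hball : closedBall x₀ r ⊆ Ω) :
    ⨍ y in ball x₀ r, u y = u x₀ := by
  have hui : IntegrableOn u (ball x₀ r) :=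
    ((hu.continuousOn.mono hball).integrableOn_compact (isCompact_closedBall x₀ r)).mono_set
      ball_subset_closedBall
  obtain ⟨δ, hδ, hδΩ⟩ := (isCompact_closedBall x₀ r).exists_cthickening_subset_open hΩ hball
  rw [cthickening_closedBall hδ.le hr.le] at hδΩ
  let χ : ContDiffBump (0 : EuclideanSpace ℝ (Fin n)) := ⟨r, δ + r, hr, by linarith⟩
  have hmem {x : EuclideanSpace ℝ (Fin n)} (hx : x ∈ closedBall 0 (δ + r)) : x₀ + x ∈ Ω :=
    hδΩ (by simpa using hx)
  have hcomp {x : EuclideanSpace ℝ (Fin n)} (hx : x ∈ closedBall 0 (δ + r)) :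
      ContDiffAt ℝ 2 (fun y => u (x₀ + y)) x :=
    (hu.contDiffAt (hΩ.mem_nhds (hmem hx))).comp x (by fun_prop)
  refine (SeparatingDual.eq_iff_forall_dual_eq (R := ℝ)).2 fun L => ?_
  let w : EuclideanSpace ℝ (Fin n) → ℝ := fun x => χ x * L (u (x₀ + x))
  have hw : ContDiff ℝ 2 w := by
    rw [contDiff_iff_contDiffAt]
    intro x
    by_cases hx : x ∈ closedBall 0 (δ + r)
    · exact χ.contDiffAt.mul (L.contDiff.contDiffAt.comp x (hcomp hx))
    · have : w =ᶠ[nhds x] fun _ => 0 := by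
        filter_upwards [isClosed_closedBall.isOpen_compl.mem_nhds hx] with y hy
        have : χ y = 0 := χ.zero_of_le_dist (not_le.1 (mt mem_closedBall.2 hy)).le
        simp [w, this]
      exact contDiffAt_const.congr_of_eventuallyEq this
  have hwc : HasCompactSupport w := χ.hasCompactSupport.mul_right
  have hwlap : ∀ x ∈ ball 0 r, lap w x = 0 := by
    intro x hx
    have hx' : x ∈ closedBall (0 : EuclideanSpace ℝ (Fin n)) (δ + r) :=
      ball_subset_closedBall (ball_subset_ball (by linarith) hx)
    have : w =ᶠ[nhds x] fun y => L (u (x₀ + y)) := by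
      filter_upwards [χ.eventuallyEq_one_of_mem_ball hx] with y hy
      simp [w, hy]
    rw [this.lap_eq, L.lap_comp (hcomp hx'), lap_comp_add_left u, hlap _ (hmem hx'), map_zero]
  have hmean := setIntegral_ball_comp_smul_eq hw hwc hr hwlap
  rw [Measure.setIntegral_comp_smul_of_pos volume w _ hr, smul_unitBall_of_pos hr] at hmean
  have hw0 : w 0 = L (u x₀) := by
    simp [w, χ.one_of_mem_closedBall (mem_closedBall_self hr.le)]
  have hwi : ∫ x in ball 0 r, w x = ∫ y in ball x₀ r, L (u y) := by
    have hpre : (fun x => x₀ + x) ⁻¹' ball x₀ r = ball 0 r := by ext; simp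
    rw [← (measurePreserving_add_left volume x₀).setIntegral_preimage_emb
      (measurableEmbedding_addLeft x₀) (fun y => L (u y)), hpre]
    refine setIntegral_congr_fun measurableSet_ball fun x hx => ?_
    simp [w, χ.one_of_mem_closedBall (ball_subset_closedBall hx)]
  have hvol : volume.real (ball x₀ r)
      = r ^ Module.finrank ℝ (EuclideanSpace ℝ (Fin n))
        * volume.real (ball (0 : EuclideanSpace ℝ (Fin n)) 1) := by
    rw [measureReal_def, measureReal_def, Measure.addHaar_ball_of_pos _ _ hr, ENNReal.toReal_mul,
      ENNReal.toReal_ofReal (by positivity)]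
  have hpos : 0 < volume.real (ball x₀ r) :=
    ENNReal.toReal_pos (measure_ball_pos _ _ hr).ne' measure_ball_lt_top.ne
  rw [setIntegral_const, hwi, hw0, smul_eq_mul, smul_eq_mul] at hmean
  rw [setAverage_eq, map_smul, ← L.integral_comp_comm hui, smul_eq_mul,
    inv_mul_eq_iff_eq_mul₀ hpos.ne', hvol, mul_assoc, ← hmean,
    mul_inv_cancel_left₀ (by positivity)]

end MeanValue

theorem Convex.convexOn_infDist {E : Type*} [SeminormedAddCommGroup E] [NormedSpace ℝ E]
    {s : Set E} (hs : Convex ℝ s) (hne : s.Nonempty) :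
    ConvexOn ℝ Set.univ fun x => infDist x s := by
  refine ⟨convex_univ, fun x _ y _ a b ha hb hab => le_of_forall_pos_lt_add fun ε hε => ?_⟩
  obtain ⟨p, hp, hxp⟩ := (infDist_lt_iff hne).1 (lt_add_of_pos_right (infDist x s) hε)
  obtain ⟨q, hq, hyq⟩ := (infDist_lt_iff hne).1 (lt_add_of_pos_right (infDist y s) hε)
  have hcomb : a • x + b • y - (a • p + b • q) = a • (x - p) + b • (y - q) := by module
  calc infDist (a • x + b • y) s
      ≤ dist (a • x + b • y) (a • p + b • q) := infDist_le_dist_of_mem (hs hp hq ha hb hab)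
    _ ≤ a * dist x p + b * dist y q := by
        rw [dist_eq_norm, dist_eq_norm, dist_eq_norm, hcomb]
        refine (norm_add_le _ _).trans ?_
        rw [norm_smul_of_nonneg ha, norm_smul_of_nonneg hb]
    _ < a • infDist x s + b • infDist y s + ε := by
        simp only [smul_eq_mul]
        rcases ha.eq_or_lt with rfl | ha'
        · obtain rfl : b = 1 := by linarith
          linarith
        · nlinarith [mul_lt_mul_of_pos_left hxp ha', mul_le_mul_of_nonneg_left hyq.le hb]

/-- If `O ⊆ ℝᵐ` is nonempty and convex and `u : Ω → ℝᵐ` is harmonic on the open set `Ω`,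
then `x ↦ dist (u x) O` is subharmonic on `Ω`: it satisfies the sub-mean-value
inequality on every ball contained in `Ω`. -/
theorem stmt3 {n m : ℕ} (O : Set (EuclideanSpace ℝ (Fin m)))
    (hne : O.Nonempty) (hconv : Convex ℝ O)
    (Ω : Set (EuclideanSpace ℝ (Fin n))) (hΩ : IsOpen Ω)
    (u : EuclideanSpace ℝ (Fin n) → EuclideanSpace ℝ (Fin m))
    (hreg : ContDiffOn ℝ 2 u Ω)
    (hharm : ∀ x ∈ Ω, lap u x = 0) :
    ∀ (x₀ : EuclideanSpace ℝ (Fin n)) (r : ℝ), 0 < r → closedBall x₀ r ⊆ Ω →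
      Metric.infDist (u x₀) O ≤ ⨍ y in ball x₀ r, Metric.infDist (u y) O := by
  intro x₀ r hr hball
  have hcont : ContinuousOn u (closedBall x₀ r) := hreg.continuousOn.mono hball
  have hdist : Continuous fun z => infDist z O := continuous_infDist_pt O
  have hint {F : Type} [NormedAddCommGroup F] {f : EuclideanSpace ℝ (Fin n) → F}
      (hf : ContinuousOn f (closedBall x₀ r)) : IntegrableOn f (ball x₀ r) :=
    (hf.integrableOn_compact (isCompact_closedBall x₀ r)).mono_set ball_subset_closedBall
  have hJensen := (hconv.convexOn_infDist hne).map_set_average_le hdist.continuousOn isClosed_univ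
    (measure_ball_pos volume x₀ hr).ne' measure_ball_lt_top.ne
    (Filter.Eventually.of_forall fun _ => Set.mem_univ _) (hint hcont)
    (hint (hdist.comp_continuousOn hcont))
  rwa [setAverage_ball_eq_of_lap_eq_zero hΩ hreg hharm hr hball] at hJensen
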